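/- Let G be a free group of finite rank r with free generating set S, acting on a standard Borel probability space (X, μ) by μ-preserving Borel automorphisms, let Σ be a G-invariant sub-σ-algebra, and let α be a generating partition with H(α) < ∞. Then lim_{n→∞} F_G(X, μ/Σ, S, B_n·α) = H(α/Σ) − (1/2)·∑_{1_G ≠ g ∈ G} δ(g, α/Σ), an equality in [−∞, ∞) in which every term δ(g, α/Σ) of the series is non-negative. -/

import Mathlib

open MeasureTheory Filter Set
open scoped ENNReal symmDiff Pointwise

namespace FPaper

/-- The free group of rank `r`; its free generating set `S` is `{FreeGroup.of i | i : Fin r}`. -/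
abbrev FG (r : ℕ) := FreeGroup (Fin r)

/-- The reduced `S`-word length of a group element. -/
def wlen {r : ℕ} (g : FG r) : ℕ := g.toWord.length

/-- The ball of radius `n` in `FG r` with respect to the word length. -/
def ball (r n : ℕ) : Set (FG r) := {g | wlen g ≤ n}

instance ballFinite (r n : ℕ) : Finite (ball r n) := by
  have h : ball r n ⊆ FreeGroup.mk '' {l : List (Fin r × Bool) | l.length ≤ n} :=
    fun g hg => ⟨g.toWord, hg, FreeGroup.mk_toWord⟩
  exact (((List.finite_length_le _ n).image _).subset h).to_subtype

/-- An action of a group `G` on a measurable space `X` by Borel automorphisms. -/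
structure BorelAction (G : Type*) [Group G] (X : Type*) [MeasurableSpace X] where
  act : G → X → X
  act_one : ∀ x, act 1 x = x
  act_mul : ∀ g h x, act (g * h) x = act g (act h x)
  measurable_act : ∀ g, Measurable (act g)

namespace BorelAction

variable {G X : Type*} [Group G] [mX : MeasurableSpace X]

/-- The action preserves the measure `μ`. -/
def Preserves (T : BorelAction G X) (μ : Measure X) : Prop :=
  ∀ g : G, MeasurePreserving (T.act g) μ μ

/-- The translated set `g · B`. -/
def smulSet (T : BorelAction G X) (g : G) (B : Set X) : Set X := T.act g⁻¹ ⁻¹' B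

/-- The translated partition `g · α`, where a countable measurable partition is recorded
by a (measurable, countably-valued) function whose fibers are the cells. -/
def tr {I : Type*} (T : BorelAction G X) (g : G) (a : X → I) : X → I :=
  fun x => a (T.act g⁻¹ x)

/-- The join `F · α = ⋁_{f ∈ F} f · α` of the translates of a partition over a set `F ⊆ G`. -/
def joinF {I : Type*} (T : BorelAction G X) (F : Set G) (a : X → I) : X → (F → I) :=
  fun x f => a (T.act (f : G)⁻¹ x)

/-- The σ-algebra generated by the partitions `f · α`, `f ∈ F`. -/
def partSA {I : Type*} (T : BorelAction G X) (F : Set G) (a : X → I) : MeasurableSpace X :=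
  ⨆ f ∈ F, MeasurableSpace.comap (T.tr f a) ⊤

/-- The partition `a` is generating: the smallest `G`-invariant σ-algebra containing `a`
(i.e. the one generated by all translates of `a`) contains every measurable set up to
`ν`-null sets. -/
def Generating {I : Type*} (T : BorelAction G X) (a : X → I) (ν : Measure X) : Prop :=
  ∀ B : Set X, MeasurableSet B →
    ∃ B', MeasurableSet[T.partSA Set.univ a] B' ∧ ν (B ∆ B') = 0


/-- Ergodicity of the action with respect to `ν`. -/
def IsErgodic (T : BorelAction G X) (ν : Measure X) : Prop :=
  ∀ B : Set X, MeasurableSet B → (∀ g : G, ν (T.smulSet g B ∆ B) = 0) → ν B = 0 ∨ ν B = 1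

/-- The action is essentially free with respect to `ν`. -/
def EssentiallyFree (T : BorelAction G X) (ν : Measure X) : Prop :=
  ν {x | ∀ g : G, g ≠ 1 → T.act g x ≠ x} = 1

/-- The stabilizer subgroup of a point. -/
def stab (T : BorelAction G X) (y : X) : Subgroup G where
  carrier := {g | T.act g y = y}
  one_mem' := T.act_one y
  mul_mem' := by
    intro g h hg hh
    simp only [Set.mem_setOf_eq] at *
    rw [T.act_mul, hh, hg]
  inv_mem' := by
    intro g hg
    simp only [Set.mem_setOf_eq] at *
    conv_lhs => rw [← hg]
    rw [← T.act_mul, inv_mul_cancel, T.act_one]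

end BorelAction

/-- `m` is a `G`-invariant sub-σ-algebra. -/
def InvariantSA {G X : Type*} [Group G] (m : MeasurableSpace X) [mX : MeasurableSpace X]
    (T : BorelAction G X) : Prop :=
  m ≤ mX ∧ ∀ (g : G) (B : Set X), MeasurableSet[m] B → MeasurableSet[m] (T.act g ⁻¹' B)

/-- A measure is purely atomic: the set of atoms has full measure. -/
def PurelyAtomic {X : Type*} [MeasurableSpace X] (ν : Measure X) : Prop :=
  ν {x | 0 < ν {x}} = 1

/-- Shannon entropy of a countable measurable partition (recorded as a countably-valued
function), with values in `[0, ∞]`. -/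
noncomputable def Hpart {X I : Type*} [MeasurableSpace X] [Countable I]
    (μ : Measure X) (a : X → I) : ℝ≥0∞ :=
  ∑' i : I, ENNReal.ofReal (Real.negMulLog (μ (a ⁻¹' {i})).toReal)

/-- Conditional Shannon entropy of a countable partition given a sub-σ-algebra `m`:
`H(α/m) = ∫ ∑_{A ∈ α} φ(E[1_A | m](x)) dμ(x)` with `φ(t) = -t log t`. -/
noncomputable def condEntS {X I : Type*} (m : MeasurableSpace X) [mX : MeasurableSpace X]
    [Countable I] (μ : Measure X) (a : X → I) : ℝ≥0∞ :=
  ∫⁻ x, ∑' i : I,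
    ENNReal.ofReal (Real.negMulLog ((μ[(a ⁻¹' {i}).indicator (fun _ => (1:ℝ)) | m]) x)) ∂μ

/-- Conditional Shannon entropy of a partition given another partition:
`H(α/β) = ∑_{B ∈ β} ∑_{A ∈ α} -μ(B) · (μ(A∩B)/μ(B)) · log (μ(A∩B)/μ(B))`
(equivalently `H(α ∨ β) − H(β)`), with values in `[0, ∞]`. -/
noncomputable def condEntP {X I J : Type*} [MeasurableSpace X] [Countable I] [Countable J]
    (μ : Measure X) (a : X → I) (b : X → J) : ℝ≥0∞ :=
  ∑' q : I × J, μ (b ⁻¹' {q.2}) *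
    ENNReal.ofReal (Real.negMulLog
      ((μ (a ⁻¹' {q.1} ∩ b ⁻¹' {q.2})).toReal / (μ (b ⁻¹' {q.2})).toReal))

/-- `F_G(X, μ, S, β) = (1-2r)·H(β) + ∑_{s ∈ S} H(s·β ∨ β)`. -/
noncomputable def FF {r : ℕ} {X I : Type*} [MeasurableSpace X] [Countable I]
    (μ : Measure X) (T : BorelAction (FG r) X) (b : X → I) : ℝ :=
  (1 - 2 * (r : ℝ)) * (Hpart μ b).toReal
    + ∑ i : Fin r, (Hpart μ (fun x => (T.tr (FreeGroup.of i) b x, b x))).toReal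

/-- The sequence `n ↦ F_G(X, μ, S, B_n · α)`. -/
noncomputable def fSeq {r : ℕ} {X : Type*} [MeasurableSpace X]
    (μ : Measure X) (T : BorelAction (FG r) X) (a : X → ℕ) (n : ℕ) : ℝ :=
  FF μ T (T.joinF (ball r n) a)

/-- The f-invariant entropy `f_G(X, μ) = lim_n F_G(X, μ, S, B_n·α)`, the limit (= infimum,
since the sequence is non-increasing) of the sequence `fSeq`, with values in `[-∞, ∞)`. -/
noncomputable def fInv {r : ℕ} {X : Type*} [MeasurableSpace X]
    (μ : Measure X) (T : BorelAction (FG r) X) (a : X → ℕ) : EReal :=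
  ⨅ n : ℕ, ((fSeq μ T a n : ℝ) : EReal)

/-- Relative version `F_G(X, μ/Σ, S, β) = (1-2r)·H(β/Σ) + ∑_{s ∈ S} H(s·β ∨ β / Σ)`. -/
noncomputable def FFrel {r : ℕ} {X I : Type*} (m : MeasurableSpace X) [mX : MeasurableSpace X]
    [Countable I] (μ : Measure X) (T : BorelAction (FG r) X) (b : X → I) : ℝ :=
  (1 - 2 * (r : ℝ)) * (condEntS m μ b).toReal
    + ∑ i : Fin r, (condEntS m μ (fun x => (T.tr (FreeGroup.of i) b x, b x))).toReal

/-- The sequence `n ↦ F_G(X, μ/Σ, S, B_n · α)`. -/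
noncomputable def fSeqRel {r : ℕ} {X : Type*} (m : MeasurableSpace X) [mX : MeasurableSpace X]
    (μ : Measure X) (T : BorelAction (FG r) X) (a : X → ℕ) (n : ℕ) : ℝ :=
  FFrel m μ T (T.joinF (ball r n) a)

/-- The relative f-invariant entropy `f_G(X, μ/Σ)`, with values in `[-∞, ∞)`. -/
noncomputable def fInvRel {r : ℕ} {X : Type*} (m : MeasurableSpace X) [mX : MeasurableSpace X]
    (μ : Measure X) (T : BorelAction (FG r) X) (a : X → ℕ) : EReal :=
  ⨅ n : ℕ, ((fSeqRel m μ T a n : ℝ) : EReal)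

/-- A total order on `S ∪ S⁻¹` is recorded by an injection `ord : Fin r × Bool → ℕ`;
`g ≺ h` iff `|g| < |h|`, or `|g| = |h|` and the reduced word of `g` lexicographically
precedes that of `h`. -/
def wlt {r : ℕ} (ord : Fin r × Bool → ℕ) (g h : FG r) : Prop :=
  wlen g < wlen h ∨ (wlen g = wlen h ∧ List.Lex (fun p q => ord p < ord q) g.toWord h.toWord)

/-- `Pre(g)`: the set of elements strictly preceding `g`. -/
def Pre {r : ℕ} (ord : Fin r × Bool → ℕ) (g : FG r) : Set (FG r) := {h | wlt ord h g}

/-- The generator or inverse generator corresponding to a letter. -/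
def letter {r : ℕ} (p : Fin r × Bool) : FG r :=
  if p.2 then FreeGroup.of p.1 else (FreeGroup.of p.1)⁻¹

/-- The first (leftmost) letter of the reduced word of `g` (junk value `1` for `g = 1`). -/
def firstLetter {r : ℕ} (g : FG r) : FG r := ((g.toWord.head?).map letter).getD 1

/-- The independence decay `δ(g, α/Σ)`, as a real number:
`δ(g, α/Σ) = H(s⁻¹g·α / Pre(s⁻¹g)·α ∨ Σ) − H(g·α / Pre(g)·α ∨ Σ)` where `s` is the first
letter of `g`. -/
noncomputable def idecay {r : ℕ} {X I : Type*} (m : MeasurableSpace X) [mX : MeasurableSpace X]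
    [Countable I] (μ : Measure X) (T : BorelAction (FG r) X)
    (ord : Fin r × Bool → ℕ) (a : X → I) (g : FG r) : ℝ :=
  (condEntS (m ⊔ T.partSA (Pre ord ((firstLetter g)⁻¹ * g)) a) μ
      (T.tr ((firstLetter g)⁻¹ * g) a)).toReal
  - (condEntS (m ⊔ T.partSA (Pre ord g) a) μ (T.tr g a)).toReal

/-- The entropy `H(τ)` of a probability space: the supremum of the Shannon entropies of
finite measurable partitions. -/
noncomputable def measEnt {M : Type*} [MeasurableSpace M] (τ : Measure M) : ℝ≥0∞ :=
  ⨆ (P : Finset (Set M)) (_ : ∀ p ∈ P, MeasurableSet p)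
    (_ : (P : Set (Set M)).PairwiseDisjoint id) (_ : ⋃₀ (P : Set (Set M)) = Set.univ),
    ∑ p ∈ P, ENNReal.ofReal (Real.negMulLog (τ p).toReal)

/-- The non-negative part of an extended real, in `ℝ≥0∞`. -/
noncomputable def erealToENNReal (x : EReal) : ℝ≥0∞ :=
  if x = ⊤ then ⊤ else ENNReal.ofReal x.toReal

/-- The integral of an `EReal`-valued function (positive part minus negative part),
with values in `[-∞, ∞]`. -/
noncomputable def eIntegral {M : Type*} [MeasurableSpace M] (τ : Measure M) (f : M → EReal) :
    EReal :=
  ((∫⁻ m, erealToENNReal (f m) ∂τ : ℝ≥0∞) : EReal)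
    - ((∫⁻ m, erealToENNReal (-(f m)) ∂τ : ℝ≥0∞) : EReal)

/-- The set of `G`-invariant Borel probability measures on `X`. -/
def InvProb {G X : Type*} [Group G] [MeasurableSpace X] (T : BorelAction G X) :
    Set (Measure X) :=
  {ν | IsProbabilityMeasure ν ∧ ∀ g : G, MeasurePreserving (T.act g) ν ν}

/-! ### Conditional probabilities and the information function -/

section CondProb

variable {X : Type*}

/-- The conditional probability of the set `A` given `m`, as an extended non-negative function. -/
noncomputable def condProb (m : MeasurableSpace X) [mX : MeasurableSpace X] (μ : Measure X)
    (A : Set X) (x : X) : ℝ≥0∞ :=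
  ENNReal.ofReal ((μ[A.indicator (fun _ => (1 : ℝ)) | m]) x)

/-- The information `-log p ∈ [0, ∞]` of an event of probability `p`. -/
noncomputable def info (p : ℝ≥0∞) : ℝ≥0∞ :=
  if p = 0 then ⊤ else ENNReal.ofReal (-Real.log p.toReal)

lemma measurable_info : Measurable info :=
  Measurable.ite (measurableSet_singleton 0) measurable_const
    (ENNReal.measurable_ofReal.comp
      (Real.measurable_log.comp ENNReal.measurable_toReal).neg)

lemma info_mul {p q : ℝ≥0∞} (hp : p ≤ 1) (hq : q ≤ 1) : info (p * q) = info p + info q := by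
  unfold info
  by_cases h0 : p = 0
  · simp [h0]
  by_cases h1 : q = 0
  · simp [h1]
  have hp' : p.toReal ≤ 1 := ENNReal.toReal_le_of_le_ofReal zero_le_one (by simpa using hp)
  have hq' : q.toReal ≤ 1 := ENNReal.toReal_le_of_le_ofReal zero_le_one (by simpa using hq)
  have hp0 : p.toReal ≠ 0 :=
    (ENNReal.toReal_pos h0 (hp.trans_lt ENNReal.one_lt_top).ne).ne'
  have hq0 : q.toReal ≠ 0 :=
    (ENNReal.toReal_pos h1 (hq.trans_lt ENNReal.one_lt_top).ne).ne'
  rw [if_neg (mul_ne_zero h0 h1), if_neg h0, if_neg h1, ENNReal.toReal_mul,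
    Real.log_mul hp0 hq0, ← ENNReal.ofReal_add, neg_add]
  · exact neg_nonneg.2 (Real.log_nonpos ENNReal.toReal_nonneg hp')
  · exact neg_nonneg.2 (Real.log_nonpos ENNReal.toReal_nonneg hq')

lemma ofReal_negMulLog_eq {t : ℝ} (ht : 0 ≤ t) :
    ENNReal.ofReal (Real.negMulLog t) = ENNReal.ofReal t * info (ENNReal.ofReal t) := by
  rcases ht.eq_or_lt with rfl | h
  · simp
  · rw [info, if_neg (by simpa using h), ENNReal.toReal_ofReal ht, ← ENNReal.ofReal_mul ht,
      Real.negMulLog]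
    congr 1; ring

/-- The Gibbs inequality for one pair of weights. -/
lemma mul_info_add_le {p q : ℝ≥0∞} (hp : p ≤ 1) (hq : q ≤ 1) :
    p * info p + p ≤ p * info q + q := by
  by_cases hp0 : p = 0
  · simp [hp0]
  by_cases hq0 : q = 0
  · simp [hq0, info, ENNReal.mul_top hp0]
  have hpt := (hp.trans_lt ENNReal.one_lt_top).ne
  have hqt := (hq.trans_lt ENNReal.one_lt_top).ne
  have hpp := ENNReal.toReal_pos hp0 hpt
  have hqp := ENNReal.toReal_pos hq0 hqt
  have hp' : p.toReal ≤ 1 := ENNReal.toReal_le_of_le_ofReal zero_le_one (by simpa using hp)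
  have hq' : q.toReal ≤ 1 := ENNReal.toReal_le_of_le_ofReal zero_le_one (by simpa using hq)
  have lp := Real.log_nonpos hpp.le hp'
  have lq := Real.log_nonpos hqp.le hq'
  unfold info
  rw [if_neg hp0, if_neg hq0]
  set s := p.toReal with hs
  set t := q.toReal with ht
  have hps : p = ENNReal.ofReal s := (ENNReal.ofReal_toReal hpt).symm
  have hqs : q = ENNReal.ofReal t := (ENNReal.ofReal_toReal hqt).symm
  rw [hps, hqs, ← ENNReal.ofReal_mul hpp.le, ← ENNReal.ofReal_mul hpp.le,
    ← ENNReal.ofReal_add (mul_nonneg hpp.le (neg_nonneg.2 lp)) hpp.le,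
    ← ENNReal.ofReal_add (mul_nonneg hpp.le (neg_nonneg.2 lq)) hqp.le]
  apply ENNReal.ofReal_le_ofReal
  have h := Real.log_le_sub_one_of_pos (div_pos hqp hpp)
  rw [Real.log_div hqp.ne' hpp.ne'] at h
  have h2 := mul_le_mul_of_nonneg_left h hpp.le
  have h3 : s * (t / s - 1) = t - s := by field_simp
  rw [h3] at h2
  linarith

variable {m M : MeasurableSpace X} [mX : MeasurableSpace X] {μ : Measure X} {A B : Set X}

lemma measurable_condProb : Measurable[m] (condProb m μ A) :=
  ENNReal.measurable_ofReal.comp stronglyMeasurable_condExp.measurable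

lemma condExp_indicator_nonneg :
    ∀ᵐ x ∂μ, 0 ≤ (μ[A.indicator (fun _ => (1 : ℝ)) | m]) x :=
  condExp_nonneg (Eventually.of_forall fun x => indicator_nonneg (fun _ _ => zero_le_one) x)

variable [IsProbabilityMeasure μ]

lemma condProb_le_one (hm : m ≤ mX) (hA : MeasurableSet A) : ∀ᵐ x ∂μ, condProb m μ A x ≤ 1 := by
  have h := condExp_mono (m := m) (μ := μ) (f := A.indicator (fun _ => (1 : ℝ)))
    (g := fun _ => (1 : ℝ)) ((integrable_const 1).indicator hA) (integrable_const 1)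
    (Eventually.of_forall fun x => indicator_le_self' (fun _ _ => zero_le_one) x)
  rw [condExp_const hm] at h
  filter_upwards [h] with x hx
  simpa [condProb] using hx

lemma setLIntegral_condProb (hm : m ≤ mX) (hA : MeasurableSet A) (hB : MeasurableSet[m] B) :
    ∫⁻ x in B, condProb m μ A x ∂μ = μ (A ∩ B) := by
  have hB' := hm B hB
  unfold condProb
  rw [← ofReal_integral_eq_lintegral_ofReal integrable_condExp.integrableOn
    (ae_restrict_of_ae condExp_indicator_nonneg),
    setIntegral_condExp hm ((integrable_const 1).indicator hA) hB, integral_indicator hA,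
    Measure.restrict_restrict hA]
  simp [Measure.real]

/-- A conditional probability given `m` may replace an indicator when integrating an
`m`-measurable function. -/
lemma setLIntegral_eq_lintegral_condProb_mul (hm : m ≤ mX) (hA : MeasurableSet A)
    {f : X → ℝ≥0∞} (hf : Measurable[m] f) :
    ∫⁻ x in A, f x ∂μ = ∫⁻ x, condProb m μ A x * f x ∂μ := by
  have hp : Measurable (condProb m μ A) := measurable_condProb.mono hm le_rfl
  have h : (μ.restrict A).trim hm = (μ.withDensity (condProb m μ A)).trim hm := by
    refine @Measure.ext X m _ _ fun s hs => ?_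
    rw [trim_measurableSet_eq hm hs, trim_measurableSet_eq hm hs, withDensity_apply _ (hm s hs),
      setLIntegral_condProb hm hA hs, Measure.restrict_apply (hm s hs), inter_comm]
  rw [← lintegral_trim hm hf, h, lintegral_trim hm hf,
    lintegral_withDensity_eq_lintegral_mul _ hp (hf.mono hm le_rfl)]
  rfl

lemma lintegral_condProb (hm : m ≤ mX) (hA : MeasurableSet A) :
    ∫⁻ x, condProb m μ A x ∂μ = μ A := by
  simpa using setLIntegral_condProb (μ := μ) hm hA MeasurableSet.univ

/-- The Bayes rule: if `M ⊇ m` has the same trace as `m` on `B ∈ M`, then on `B` the conditional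
probability of `A ∩ B` given `m` is the product of those of `A` given `M` and of `B` given `m`. -/
lemma condProb_inter (hmM : m ≤ M) (hMX : M ≤ mX) (hA : MeasurableSet A)
    (hBM : MeasurableSet[M] B)
    (hB : ∀ D, MeasurableSet[M] D → ∃ C, MeasurableSet[m] C ∧ D ∩ B = C ∩ B) :
    ∀ᵐ x ∂μ, x ∈ B → condProb m μ (A ∩ B) x = condProb M μ A x * condProb m μ B x := by
  have hm : m ≤ mX := hmM.trans hMX
  have hBX : MeasurableSet B := hMX B hBM
  set p := condProb m μ (A ∩ B)
  set q := condProb m μ B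
  set u := condProb M μ A
  have hp : Measurable[m] p := measurable_condProb
  have hq : Measurable[m] q := measurable_condProb
  have hu : Measurable[M] u := measurable_condProb
  have huq : Measurable[M] fun x => u x * q x := hu.mul (hq.mono hmM le_rfl)
  have key : B.indicator p =ᵐ[μ.trim hMX] B.indicator (fun x => u x * q x) := by
    refine @ae_eq_of_forall_setLIntegral_eq_of_sigmaFinite X M _ _ _ _
      ((hp.mono hmM le_rfl).indicator hBM) (huq.indicator hBM) ?_
    intro D hD _
    obtain ⟨C, hC, hDC⟩ := hB D hD
    rw [restrict_trim hMX _ hD, lintegral_trim hMX ((hp.mono hmM le_rfl).indicator hBM),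
      lintegral_trim hMX (huq.indicator hBM)]
    rw [lintegral_indicator hBX, lintegral_indicator hBX, Measure.restrict_restrict hBX,
      inter_comm B D, hDC]
    have hCX := hm C hC
    calc ∫⁻ x in C ∩ B, p x ∂μ = ∫⁻ x in B, C.indicator p x ∂μ := by
          rw [lintegral_indicator hCX, Measure.restrict_restrict hCX]
      _ = ∫⁻ x, q x * C.indicator p x ∂μ :=
          setLIntegral_eq_lintegral_condProb_mul hm hBX (hp.indicator hC)
      _ = ∫⁻ x, p x * C.indicator q x ∂μ := by
          refine lintegral_congr fun x => ?_
          by_cases hx : x ∈ C <;> simp [hx, mul_comm]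
      _ = ∫⁻ x in A ∩ B, C.indicator q x ∂μ :=
          (setLIntegral_eq_lintegral_condProb_mul hm (hA.inter hBX) (hq.indicator hC)).symm
      _ = ∫⁻ x in A, (C ∩ B).indicator q x ∂μ := by
          rw [lintegral_indicator hCX, lintegral_indicator (hCX.inter hBX),
            Measure.restrict_restrict hCX, Measure.restrict_restrict (hCX.inter hBX)]
          congr 2
          ext x; simp only [mem_inter_iff]; tauto
      _ = ∫⁻ x, u x * (C ∩ B).indicator q x ∂μ :=
          setLIntegral_eq_lintegral_condProb_mul hMX hA
            ((hq.mono hmM le_rfl).indicator (MeasurableSet.inter (hmM C hC) hBM))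
      _ = ∫⁻ x in C ∩ B, u x * q x ∂μ := by
          rw [← lintegral_indicator (hCX.inter hBX)]
          refine lintegral_congr fun x => ?_
          by_cases hx : x ∈ C ∩ B <;> simp only [hx, indicator_of_mem, indicator_of_notMem,
            not_false_eq_true, mul_zero]
  filter_upwards [ae_eq_of_ae_eq_trim key] with x hx hxB
  simpa [indicator_of_mem hxB] using hx

end CondProb
/-! ### Conditional entropy of countable partitions -/

/-- On a cell `B` of `b`, the σ-algebra `m ⊔ comap b ⊤` has the same trace as `m`. -/
lemma exists_inter_fiber_eq {X J : Type*} {m : MeasurableSpace X} {b : X → J} {D : Set X} (j : J)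
    (hD : MeasurableSet[m ⊔ MeasurableSpace.comap b ⊤] D) :
    ∃ C, MeasurableSet[m] C ∧ D ∩ b ⁻¹' {j} = C ∩ b ⁻¹' {j} := by
  let M : MeasurableSpace X :=
    { MeasurableSet' := fun D => ∃ C, MeasurableSet[m] C ∧ D ∩ b ⁻¹' {j} = C ∩ b ⁻¹' {j}
      measurableSet_empty := ⟨∅, @MeasurableSet.empty _ m, rfl⟩
      measurableSet_compl := by
        rintro D ⟨C, hC, h⟩
        refine ⟨Cᶜ, hC.compl, ?_⟩
        ext x
        have := Set.ext_iff.1 h x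
        simp only [mem_inter_iff, mem_compl_iff] at this ⊢
        tauto
      measurableSet_iUnion := by
        intro D hD
        choose C hC h using hD
        refine ⟨⋃ n, C n, MeasurableSet.iUnion hC, ?_⟩
        rw [iUnion_inter, iUnion_inter]
        exact iUnion_congr h }
  have h1 : m ≤ M := fun C hC => ⟨C, hC, rfl⟩
  have h2 : MeasurableSpace.comap b ⊤ ≤ M := by
    rintro _ ⟨t, -, rfl⟩
    by_cases hj : j ∈ t
    · refine ⟨univ, @MeasurableSet.univ _ m, ?_⟩
      ext x
      simp only [mem_inter_iff, mem_preimage, mem_singleton_iff, mem_univ, true_and,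
        and_iff_right_iff_imp]
      rintro rfl; exact hj
    · refine ⟨∅, @MeasurableSet.empty _ m, ?_⟩
      ext x
      simp only [mem_inter_iff, mem_preimage, mem_singleton_iff, mem_empty_iff_false, false_and,
        iff_false, not_and]
      rintro h rfl; exact hj h
  exact sup_le h1 h2 D hD

section CondEnt

variable {X I J : Type*} [Countable I] [Countable J] {m m' : MeasurableSpace X}
  [mX : MeasurableSpace X] {μ : Measure X} {a : X → I} {b : X → J}

lemma setLIntegral_eq_tsum_fiber {A : Set X} (hA : MeasurableSet A)
    (hb : ∀ j, MeasurableSet (b ⁻¹' {j})) (f : X → ℝ≥0∞) :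
    ∫⁻ x in A, f x ∂μ = ∑' j, ∫⁻ x in A ∩ b ⁻¹' {j}, f x ∂μ := by
  have h : A = ⋃ j, A ∩ b ⁻¹' {j} := by
    ext x; simp
  conv_lhs => rw [h]
  refine lintegral_iUnion (fun j => hA.inter (hb j)) (fun i j hij => ?_) f
  refine Set.disjoint_left.2 fun x hx hy => hij ?_
  exact hx.2.symm.trans hy.2

/-- Relabelling the cells of a partition does not change its conditional entropy. -/
lemma condEntS_equiv_comp (e : I ≃ J) : condEntS m μ (e ∘ a) = condEntS m μ a := by
  unfold condEntS
  refine lintegral_congr fun x => ?_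
  rw [← e.tsum_eq]
  refine tsum_congr fun i => ?_
  have : (e ∘ a) ⁻¹' {e i} = a ⁻¹' {i} := by ext y; simp
  rw [this]

lemma sup_comap_le (hm : m ≤ mX) (hb : ∀ j, MeasurableSet (b ⁻¹' {j})) :
    m ⊔ MeasurableSpace.comap b ⊤ ≤ mX := by
  refine sup_le hm ?_
  rintro _ ⟨t, -, rfl⟩
  rw [← biUnion_of_singleton t, preimage_iUnion₂]
  exact MeasurableSet.biUnion t.to_countable fun j _ => hb j

variable [IsProbabilityMeasure μ]

lemma condEntS_eq_tsum (hm : m ≤ mX) (ha : ∀ i, MeasurableSet (a ⁻¹' {i})) :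
    condEntS m μ a = ∑' i, ∫⁻ x in a ⁻¹' {i}, info (condProb m μ (a ⁻¹' {i}) x) ∂μ := by
  unfold condEntS
  rw [lintegral_tsum]
  · refine tsum_congr fun i => ?_
    rw [setLIntegral_eq_lintegral_condProb_mul hm (ha i) (f := fun x => info (condProb m μ _ x))
      (measurable_info.comp measurable_condProb)]
    refine lintegral_congr_ae ?_
    filter_upwards [condExp_indicator_nonneg (m := m) (μ := μ) (A := a ⁻¹' {i})] with x hx
    exact ofReal_negMulLog_eq hx
  · intro i
    exact ((Real.continuous_negMulLog.measurable.comp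
      (stronglyMeasurable_condExp.measurable.mono hm le_rfl)).ennreal_ofReal).aemeasurable

/-- The chain rule `H(α ∨ β / Σ) = H(α / β ∨ Σ) + H(β / Σ)`. -/
lemma condEntS_prod (hm : m ≤ mX) (ha : ∀ i, MeasurableSet (a ⁻¹' {i}))
    (hb : ∀ j, MeasurableSet (b ⁻¹' {j})) :
    condEntS m μ (fun x => (a x, b x)) =
      condEntS (m ⊔ MeasurableSpace.comap b ⊤) μ a + condEntS m μ b := by
  have hMX := sup_comap_le hm hb
  have hpre : ∀ p : I × J, (fun x => (a x, b x)) ⁻¹' {p} = a ⁻¹' {p.1} ∩ b ⁻¹' {p.2} := by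
    intro p; ext x; simp [Prod.ext_iff]
  have hab : ∀ p : I × J, MeasurableSet ((fun x => (a x, b x)) ⁻¹' {p}) := fun p => by
    rw [hpre]; exact (ha p.1).inter (hb p.2)
  rw [condEntS_eq_tsum hm hab, condEntS_eq_tsum hMX ha, condEntS_eq_tsum hm hb]
  have hsplit : ∀ p : I × J,
      ∫⁻ x in (fun x => (a x, b x)) ⁻¹' {p},
        info (condProb m μ ((fun x => (a x, b x)) ⁻¹' {p}) x) ∂μ
      = (∫⁻ x in a ⁻¹' {p.1} ∩ b ⁻¹' {p.2},
          info (condProb (m ⊔ MeasurableSpace.comap b ⊤) μ (a ⁻¹' {p.1}) x) ∂μ)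
        + ∫⁻ x in b ⁻¹' {p.2} ∩ a ⁻¹' {p.1}, info (condProb m μ (b ⁻¹' {p.2}) x) ∂μ := by
    intro p
    rw [hpre, inter_comm (b ⁻¹' {p.2}), ← lintegral_add_left]
    · refine setLIntegral_congr_fun_ae ((ha p.1).inter (hb p.2)) ?_
      filter_upwards [condProb_inter le_sup_left hMX (ha p.1)
        ((le_sup_right : MeasurableSpace.comap b ⊤ ≤ m ⊔ MeasurableSpace.comap b ⊤) _
          ⟨{p.2}, trivial, rfl⟩) fun D hD => exists_inter_fiber_eq p.2 hD,
        condProb_le_one hMX (ha p.1), condProb_le_one hm (hb p.2)] with x hx h1 h2 hxm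
      rw [hx hxm.2, info_mul h1 h2]
    · exact measurable_info.comp (measurable_condProb.mono hMX le_rfl)
  rw [tsum_congr hsplit, ENNReal.tsum_add]
  congr 1
  · rw [ENNReal.tsum_prod']
    exact tsum_congr fun i => (setLIntegral_eq_tsum_fiber (ha i) hb fun x =>
      info (condProb (m ⊔ MeasurableSpace.comap b ⊤) μ (a ⁻¹' {i}) x)).symm
  · rw [ENNReal.tsum_prod', ENNReal.tsum_comm]
    exact tsum_congr fun j => (setLIntegral_eq_tsum_fiber (hb j) ha fun x =>
      info (condProb m μ (b ⁻¹' {j}) x)).symm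

/-- Conditional entropy decreases when the conditioning σ-algebra increases. -/
lemma condEntS_anti (hmm' : m ≤ m') (hm' : m' ≤ mX) (ha : ∀ i, MeasurableSet (a ⁻¹' {i})) :
    condEntS m' μ a ≤ condEntS m μ a := by
  have hm := hmm'.trans hm'
  rw [condEntS_eq_tsum hm' ha, condEntS_eq_tsum hm ha]
  refine ENNReal.tsum_le_tsum fun i => ?_
  set A := a ⁻¹' {i}
  have hc : Measurable[m] (fun x => info (condProb m μ A x)) :=
    measurable_info.comp measurable_condProb
  rw [setLIntegral_eq_lintegral_condProb_mul hm' (ha i) (f := fun x => info (condProb m' μ A x))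
      (measurable_info.comp measurable_condProb),
    setLIntegral_eq_lintegral_condProb_mul hm' (ha i) (hc.mono hmm' le_rfl)]
  have h : ∫⁻ x, condProb m' μ A x * info (condProb m' μ A x) + condProb m' μ A x ∂μ
      ≤ ∫⁻ x, condProb m' μ A x * info (condProb m μ A x) + condProb m μ A x ∂μ := by
    refine lintegral_mono_ae ?_
    filter_upwards [condProb_le_one hm' (ha i), condProb_le_one hm (ha i)] with x h1 h2
    exact mul_info_add_le h1 h2
  rw [lintegral_add_right _ (measurable_condProb.mono hm' le_rfl),
    lintegral_add_right _ (measurable_condProb.mono hm le_rfl),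
    lintegral_condProb hm (ha i), lintegral_condProb hm' (ha i)] at h
  exact (ENNReal.add_le_add_iff_right (measure_ne_top μ A)).1 h

lemma condEntS_bot (ha : ∀ i, MeasurableSet (a ⁻¹' {i})) : condEntS ⊥ μ a = Hpart μ a := by
  unfold condEntS Hpart
  simp_rw [condExp_bot, integral_indicator_const (1 : ℝ) (ha _)]
  simp [Measure.real]

lemma condEntS_le_Hpart (hm : m ≤ mX) (ha : ∀ i, MeasurableSet (a ⁻¹' {i})) :
    condEntS m μ a ≤ Hpart μ a := by
  rw [← condEntS_bot ha]
  exact condEntS_anti bot_le hm ha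

/-- A partition that is coarser than `m` has no entropy given `m`. -/
lemma condEntS_eq_zero (hm : m ≤ mX) (ha : ∀ i, MeasurableSet[m] (a ⁻¹' {i})) :
    condEntS m μ a = 0 := by
  unfold condEntS
  have : ∀ i x, ENNReal.ofReal (Real.negMulLog
      ((μ[(a ⁻¹' {i}).indicator (fun _ => (1 : ℝ)) | m]) x)) = 0 := by
    intro i x
    rw [condExp_of_stronglyMeasurable hm (stronglyMeasurable_const.indicator (ha i))
      ((integrable_const 1).indicator (hm _ (ha i)))]
    by_cases hx : x ∈ a ⁻¹' {i} <;> simp [indicator, hx]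
  simp [this]

/-- A coarser partition has smaller conditional entropy. -/
lemma condEntS_le_of_factor (hm : m ≤ mX) (ha : ∀ i, MeasurableSet (a ⁻¹' {i}))
    (hb : ∀ j, MeasurableSet (b ⁻¹' {j})) (h : ∀ x y, b x = b y → a x = a y) :
    condEntS m μ a ≤ condEntS m μ b := by
  have h1 := condEntS_prod (μ := μ) hm ha hb
  rw [condEntS_eq_zero (sup_comap_le hm hb), zero_add] at h1
  · rw [← h1, ← condEntS_equiv_comp (Equiv.prodComm I J)]
    exact (le_add_self).trans_eq (condEntS_prod hm hb ha).symm
  · intro i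
    refine (le_sup_right : MeasurableSpace.comap b ⊤ ≤ m ⊔ MeasurableSpace.comap b ⊤) _
      ⟨b '' (a ⁻¹' {i}), trivial, ?_⟩
    ext x
    constructor
    · rintro ⟨y, hy, hyx⟩
      exact (h x y hyx.symm).trans hy
    · exact fun hx => ⟨x, hx, rfl⟩

lemma condEntS_congr_factor (hm : m ≤ mX) (ha : ∀ i, MeasurableSet (a ⁻¹' {i}))
    (hb : ∀ j, MeasurableSet (b ⁻¹' {j})) (h : ∀ x y, b x = b y ↔ a x = a y) :
    condEntS m μ a = condEntS m μ b :=
  le_antisymm (condEntS_le_of_factor hm ha hb fun x y => (h x y).1)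
    (condEntS_le_of_factor hm hb ha fun x y => (h x y).2)

end CondEnt
/-! ### The entropy of the joins of translates as a set function -/

/-- Conditional entropy is invariant under automorphisms preserving `m` and `μ`. -/
lemma condEntS_comp_measurableEquiv {X I : Type*} [Countable I] {m : MeasurableSpace X}
    [mX : MeasurableSpace X] {μ : Measure X} [IsProbabilityMeasure μ] (hm : m ≤ mX)
    (e : X ≃ᵐ X) (he : MeasurePreserving e μ μ)
    (h1 : ∀ B, MeasurableSet[m] B → MeasurableSet[m] (e ⁻¹' B))
    (h2 : ∀ B, MeasurableSet[m] B → MeasurableSet[m] (e.symm ⁻¹' B))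
    {b : X → I} (hb : ∀ i, MeasurableSet (b ⁻¹' {i})) :
    condEntS m μ (b ∘ e) = condEntS m μ b := by
  have key : ∀ i, (μ[(b ⁻¹' {i}).indicator (fun _ => (1 : ℝ)) | m]) ∘ e
      =ᵐ[μ] μ[((b ∘ e) ⁻¹' {i}).indicator (fun _ => (1 : ℝ)) | m] := by
    intro i
    have hmeas : MeasurableSet ((b ∘ e) ⁻¹' {i}) := e.measurable (hb i)
    have h_integrable : Integrable ((μ[(b ⁻¹' {i}).indicator (fun _ => (1 : ℝ)) | m]) ∘ e) μ :=
      he.integrable_comp_of_integrable integrable_condExp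
    refine ae_eq_condExp_of_forall_setIntegral_eq hm ((integrable_const 1).indicator hmeas)
      (fun s _ _ => h_integrable.integrableOn) (fun s hs _ => ?_) ?_
    · have hs' : s = e ⁻¹' (e.symm ⁻¹' s) := by ext x; simp
      rw [hs', show ((b ∘ e) ⁻¹' {i}).indicator (fun _ => (1 : ℝ))
        = (b ⁻¹' {i}).indicator (fun _ => (1 : ℝ)) ∘ e from rfl]
      simp only [Function.comp_apply]
      rw [he.setIntegral_preimage_emb e.measurableEmbedding,
        he.setIntegral_preimage_emb e.measurableEmbedding
          ((b ⁻¹' {i}).indicator (fun _ => (1 : ℝ))),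
        setIntegral_condExp hm ((integrable_const 1).indicator (hb i)) (h2 s hs)]
    · have : Measurable[m] ((μ[(b ⁻¹' {i}).indicator (fun _ => (1 : ℝ)) | m]) ∘ e) :=
        stronglyMeasurable_condExp.measurable.comp fun B hB => h1 B hB
      exact this.stronglyMeasurable.aestronglyMeasurable
  have hsum : ∀ᵐ x ∂μ, ∀ i, (μ[(b ⁻¹' {i}).indicator (fun _ => (1 : ℝ)) | m]) (e x)
      = (μ[((b ∘ e) ⁻¹' {i}).indicator (fun _ => (1 : ℝ)) | m]) x :=
    ae_all_iff.2 fun i => key i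
  unfold condEntS
  conv_rhs => rw [← he.lintegral_comp_emb e.measurableEmbedding]
  refine lintegral_congr_ae ?_
  filter_upwards [hsum] with x hx
  exact tsum_congr fun i => by rw [hx i]

/-- The conditional entropy of the join of the translates of `a` over a finite set. -/
noncomputable def joinEnt {G X : Type*} [Group G] (m : MeasurableSpace X)
    [mX : MeasurableSpace X] (μ : Measure X) (T : BorelAction G X) (a : X → ℕ) (F : Finset G) : ℝ :=
  (condEntS m μ (T.joinF (F : Set G) a)).toReal

section Action

variable {G X : Type*} [Group G] {m : MeasurableSpace X} [mX : MeasurableSpace X]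
  {T : BorelAction G X} {a : X → ℕ}

/-- The automorphism of `X` induced by a group element. -/
def BorelAction.equiv (T : BorelAction G X) (g : G) : X ≃ᵐ X where
  toFun := T.act g
  invFun := T.act g⁻¹
  left_inv x := by rw [← T.act_mul, inv_mul_cancel, T.act_one]
  right_inv x := by rw [← T.act_mul, mul_inv_cancel, T.act_one]
  measurable_toFun := T.measurable_act g
  measurable_invFun := T.measurable_act g⁻¹

lemma joinF_eq_iff {F : Set G} {x y : X} :
    T.joinF F a x = T.joinF F a y ↔ ∀ f ∈ F, a (T.act f⁻¹ x) = a (T.act f⁻¹ y) :=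
  ⟨fun h f hf => congrFun h ⟨f, hf⟩, fun h => funext fun f => h f f.2⟩

lemma measurable_joinF (F : Set G) (ha : Measurable a) : Measurable (T.joinF F a) :=
  measurable_pi_iff.2 fun _ => ha.comp (T.measurable_act _)

lemma measurableSet_joinF_fiber (F : Set G) [Finite F] (ha : Measurable a) (i : F → ℕ) :
    MeasurableSet (T.joinF F a ⁻¹' {i}) :=
  measurable_joinF F ha (measurableSet_singleton i)

lemma measurableSet_tr_fiber (g : G) (ha : Measurable a) (i : ℕ) :
    MeasurableSet (T.tr g a ⁻¹' {i}) :=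
  (ha.comp (T.measurable_act _)) (measurableSet_singleton i)

lemma partSA_eq_comap_joinF (F : Set G) [Finite F] :
    T.partSA F a = MeasurableSpace.comap (T.joinF F a) ⊤ := by
  have h : (⊤ : MeasurableSpace (F → ℕ)) = MeasurableSpace.pi :=
    (MeasurableSpace.ext fun s => ⟨fun _ => s.to_countable.measurableSet, fun _ => trivial⟩)
  rw [h, MeasurableSpace.pi, MeasurableSpace.comap_iSup, BorelAction.partSA, iSup_subtype']
  refine iSup_congr fun f => ?_
  rw [MeasurableSpace.comap_comp]
  rfl

variable {μ : Measure X}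

lemma Hpart_tr (hT : T.Preserves μ) (ha : Measurable a) (g : G) :
    Hpart μ (T.tr g a) = Hpart μ a := by
  unfold Hpart
  refine tsum_congr fun i => ?_
  have : T.tr g a ⁻¹' {i} = T.act g⁻¹ ⁻¹' (a ⁻¹' {i}) := rfl
  rw [this, (hT g⁻¹).measure_preimage (ha (measurableSet_singleton i)).nullMeasurableSet]

variable [IsProbabilityMeasure μ]

lemma condEntS_joinF_congr (hm : m ≤ mX) (ha : Measurable a) {F K : Set G} [Finite F] [Finite K]
    (h : F = K) : condEntS m μ (T.joinF F a) = condEntS m μ (T.joinF K a) := by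
  subst h
  exact condEntS_congr_factor hm (measurableSet_joinF_fiber F ha)
    (measurableSet_joinF_fiber F ha) fun x y => Iff.rfl

/-- The chain rule for joins of translates. -/
lemma condEntS_joinF_union (hm : m ≤ mX) (ha : Measurable a) (F K : Set G) [Finite F] [Finite K] :
    condEntS m μ (T.joinF (F ∪ K) a) =
      condEntS (m ⊔ MeasurableSpace.comap (T.joinF K a) ⊤) μ (T.joinF F a)
        + condEntS m μ (T.joinF K a) := by
  have hF := measurableSet_joinF_fiber (T := T) F ha
  have hK := measurableSet_joinF_fiber (T := T) K ha
  rw [← condEntS_prod hm hF hK]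
  refine condEntS_congr_factor hm (measurableSet_joinF_fiber _ ha) (fun p => ?_) fun x y => ?_
  · exact ((measurable_joinF F ha).prodMk (measurable_joinF K ha)) (measurableSet_singleton p)
  · simp only [Prod.mk.injEq, joinF_eq_iff, mem_union]
    exact ⟨fun h f hf => hf.elim (h.1 f) (h.2 f),
      fun h => ⟨fun f hf => h f (Or.inl hf), fun f hf => h f (Or.inr hf)⟩⟩

lemma condEntS_joinF_singleton (hm : m ≤ mX) (ha : Measurable a) (g : G) :
    condEntS m μ (T.joinF {g} a) = condEntS m μ (T.tr g a) :=
  condEntS_congr_factor hm (measurableSet_joinF_fiber _ ha) (measurableSet_tr_fiber g ha)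
    fun x y => by simp [joinF_eq_iff, BorelAction.tr]

lemma condEntS_joinF_empty (hm : m ≤ mX) :
    condEntS m μ (T.joinF ((∅ : Finset G) : Set G) a) = 0 := by
  refine condEntS_eq_zero hm fun i => ?_
  have : T.joinF ((∅ : Finset G) : Set G) a ⁻¹' {i} = univ :=
    eq_univ_of_forall fun x => funext fun f => absurd f.2 (by simp)
  rw [this]
  exact @MeasurableSet.univ _ m

lemma joinEnt_empty (hm : m ≤ mX) : joinEnt m μ T a ∅ = 0 := by
  rw [joinEnt, condEntS_joinF_empty hm, ENNReal.toReal_zero]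

lemma condEntS_joinF_ne_top (hm : m ≤ mX) (hT : T.Preserves μ) (ha : Measurable a)
    (hent : Hpart μ a < ⊤) (F : Finset G) : condEntS m μ (T.joinF (F : Set G) a) ≠ ⊤ := by
  classical
  induction F using Finset.induction_on with
  | empty =>
    rw [condEntS_joinF_empty hm]
    exact ENNReal.zero_ne_top
  | insert g F _ ih =>
    have h := condEntS_joinF_union (T := T) (μ := μ) hm ha {g} (F : Set G)
    have hM := sup_comap_le hm (measurableSet_joinF_fiber (T := T) (F : Set G) ha)
    rw [condEntS_joinF_singleton hM ha] at h
    rw [condEntS_joinF_congr hm ha (show ((insert g F : Finset G) : Set G) = {g} ∪ (F : Set G) by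
      simp), h]
    refine ENNReal.add_ne_top.2 ⟨?_, ih⟩
    refine ((condEntS_le_Hpart hM (measurableSet_tr_fiber g ha)).trans_lt ?_).ne
    rwa [Hpart_tr hT ha]

variable [DecidableEq G]

lemma toReal_condEntS_sup (hm : m ≤ mX) (hT : T.Preserves μ) (ha : Measurable a)
    (hent : Hpart μ a < ⊤) (F K : Finset G) :
    (condEntS (m ⊔ MeasurableSpace.comap (T.joinF (K : Set G) a) ⊤) μ
      (T.joinF (F : Set G) a)).toReal = joinEnt m μ T a (F ∪ K) - joinEnt m μ T a K := by
  have h := condEntS_joinF_union (T := T) (μ := μ) hm ha (F : Set G) (K : Set G)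
  have hM := sup_comap_le hm (measurableSet_joinF_fiber (T := T) (K : Set G) ha)
  unfold joinEnt
  rw [condEntS_joinF_congr hm ha (Finset.coe_union F K), h, ENNReal.toReal_add
    (condEntS_joinF_ne_top hM hT ha hent F) (condEntS_joinF_ne_top hm hT ha hent K)]
  ring

/-- Strong subadditivity: conditioning on more translates decreases entropy. -/
lemma joinEnt_union_sub_anti (hm : m ≤ mX) (hT : T.Preserves μ) (ha : Measurable a)
    (hent : Hpart μ a < ⊤) (F : Finset G) {K L : Finset G} (hKL : K ⊆ L) :
    joinEnt m μ T a (F ∪ L) - joinEnt m μ T a L ≤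
      joinEnt m μ T a (F ∪ K) - joinEnt m μ T a K := by
  rw [← toReal_condEntS_sup hm hT ha hent, ← toReal_condEntS_sup hm hT ha hent]
  have hM : ∀ K : Finset G, m ⊔ MeasurableSpace.comap (T.joinF (K : Set G) a) ⊤ ≤ mX :=
    fun K => sup_comap_le hm (measurableSet_joinF_fiber (T := T) (K : Set G) ha)
  refine ENNReal.toReal_mono (condEntS_joinF_ne_top (hM K) hT ha hent F)
    (condEntS_anti (sup_le_sup_left ?_ m) (hM L) (measurableSet_joinF_fiber _ ha))
  rw [← partSA_eq_comap_joinF, ← partSA_eq_comap_joinF]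
  exact biSup_mono fun f hf => hKL hf

lemma joinEnt_smul (hm : InvariantSA m T) (hT : T.Preserves μ) (ha : Measurable a)
    (g : G) (F : Finset G) : joinEnt m μ T a (g • F) = joinEnt m μ T a F := by
  unfold joinEnt
  rw [← condEntS_comp_measurableEquiv hm.1 (T.equiv g⁻¹) (hT g⁻¹) (hm.2 g⁻¹) (hm.2 g⁻¹⁻¹)
    (measurableSet_joinF_fiber (T := T) (F : Set G) ha)]
  congr 1
  refine condEntS_congr_factor hm.1 (measurableSet_joinF_fiber _ ha) (fun i => ?_) fun x y => ?_
  · exact (T.measurable_act g⁻¹) (measurableSet_joinF_fiber (T := T) (F : Set G) ha i)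
  · have : ∀ z, (T.equiv g⁻¹) z = T.act g⁻¹ z := fun z => rfl
    simp only [Function.comp_apply, joinF_eq_iff, this, ← T.act_mul, Finset.coe_smul_finset,
      Set.mem_smul_set, forall_exists_index, and_imp, forall_apply_eq_imp_iff₂, smul_eq_mul,
      mul_inv_rev]

end Action
/-! ### Words, balls and the well-order of the free group -/

section Words

variable {r : ℕ}

lemma letter_eq_mk (p : Fin r × Bool) : letter p = FreeGroup.mk [p] := by
  obtain ⟨i, b⟩ := p
  cases b <;> rfl

lemma letter_inv (p : Fin r × Bool) : (letter p)⁻¹ = letter (p.1, !p.2) := by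
  obtain ⟨i, b⟩ := p
  cases b <;> simp [letter]

lemma toWord_letter_mul (p : Fin r × Bool) (k : FG r) :
    (letter p * k).toWord =
      if k.toWord.head? = some (p.1, !p.2) then k.toWord.tail else p :: k.toWord := by
  have h : letter p * k = FreeGroup.mk (p :: k.toWord) := by
    rw [letter_eq_mk]
    conv_lhs => rw [← FreeGroup.mk_toWord (x := k)]
    rfl
  rw [h, FreeGroup.toWord_mk, FreeGroup.reduce.cons, FreeGroup.reduce_toWord]
  rcases k.toWord with _ | ⟨q, w⟩
  · simp
  · obtain ⟨i, b⟩ := p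
    obtain ⟨j, c⟩ := q
    by_cases hij : i = j <;> cases b <;> cases c <;> simp [hij, eq_comm]

lemma wlen_letter_mul_le (p : Fin r × Bool) (k : FG r) : wlen (letter p * k) ≤ wlen k + 1 := by
  unfold wlen
  rw [toWord_letter_mul]
  split_ifs <;> simp; omega

/-- Every non-trivial element is its first letter times an element of smaller length. -/
lemma exists_eq_letter_mul {g : FG r} (hg : g ≠ 1) :
    ∃ p k, g = letter p * k ∧ g.toWord = p :: k.toWord ∧ firstLetter g = letter p ∧
      (firstLetter g)⁻¹ * g = k := by
  rcases hw : g.toWord with _ | ⟨p, w⟩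
  · exact absurd (FreeGroup.toWord_eq_nil_iff.1 hw) hg
  · have hf : firstLetter g = letter p := by simp [firstLetter, hw]
    have hk : ((letter p)⁻¹ * g).toWord = w := by
      rw [letter_inv, toWord_letter_mul, hw]
      simp
    exact ⟨p, (letter p)⁻¹ * g, by group, by rw [hk], hf, by rw [hf]⟩

lemma wlen_firstLetter_inv_mul {g : FG r} (hg : g ≠ 1) :
    wlen ((firstLetter g)⁻¹ * g) + 1 = wlen g := by
  obtain ⟨p, k, -, hw, -, hk⟩ := exists_eq_letter_mul hg
  rw [hk, wlen, wlen, hw, List.length_cons]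

lemma wlen_eq_zero {g : FG r} : wlen g = 0 ↔ g = 1 := by
  rw [wlen, List.length_eq_zero_iff, FreeGroup.toWord_eq_nil_iff]

/-- The ball of radius `n` as a finset. -/
noncomputable def ballF (r n : ℕ) : Finset (FG r) := (Set.toFinite (ball r n)).toFinset

lemma coe_ballF (n : ℕ) : (ballF r n : Set (FG r)) = ball r n := by simp [ballF]

lemma mem_ballF {n : ℕ} {g : FG r} : g ∈ ballF r n ↔ wlen g ≤ n := by
  simp [ballF, ball]

lemma ballF_zero : ballF r 0 = {1} := by
  ext g
  rw [mem_ballF, Nat.le_zero, wlen_eq_zero, Finset.mem_singleton]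

lemma ballF_mono : Monotone (ballF r) := fun _ _ h _ hg =>
  mem_ballF.2 ((mem_ballF.1 hg).trans h)

lemma letter_smul_ballF_subset (p : Fin r × Bool) (n : ℕ) :
    letter p • ballF r n ⊆ ballF r (n + 1) := by
  intro g hg
  obtain ⟨k, hk, rfl⟩ := Finset.mem_smul_finset.1 hg
  exact mem_ballF.2 ((wlen_letter_mul_le p k).trans (Nat.succ_le_succ (mem_ballF.1 hk)))

lemma ballF_succ (n : ℕ) :
    ballF r (n + 1) =
      (Finset.univ.biUnion fun p : Fin r × Bool => letter p • ballF r n) ∪ ballF r n := by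
  ext g
  constructor
  · intro hg
    by_cases h1 : g = 1
    · exact Finset.mem_union_right _ (mem_ballF.2 (by rw [wlen_eq_zero.2 h1]; omega))
    · obtain ⟨p, k, hgk, -, -, hk⟩ := exists_eq_letter_mul h1
      refine Finset.mem_union_left _ (Finset.mem_biUnion.2 ⟨p, Finset.mem_univ _, ?_⟩)
      refine Finset.mem_smul_finset.2 ⟨k, mem_ballF.2 ?_, hgk.symm⟩
      have := wlen_firstLetter_inv_mul h1
      rw [hk] at this
      have := mem_ballF.1 hg
      omega
  · intro hg
    rcases Finset.mem_union.1 hg with h | h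
    · obtain ⟨p, -, hp⟩ := Finset.mem_biUnion.1 h
      exact letter_smul_ballF_subset p n hp
    · exact ballF_mono n.le_succ h

/-- The sphere of radius `n`. -/
noncomputable def sphere (r n : ℕ) : Finset (FG r) := (ballF r n).filter fun g => wlen g = n

lemma mem_sphere {n : ℕ} {g : FG r} : g ∈ sphere r n ↔ wlen g = n := by
  simp only [sphere, Finset.mem_filter, mem_ballF]
  exact ⟨fun h => h.2, fun h => ⟨h.le, h⟩⟩

lemma sum_ballF_succ (f : FG r → ℝ) (n : ℕ) :
    ∑ g ∈ ballF r (n + 1), f g = ∑ g ∈ ballF r n, f g + ∑ g ∈ sphere r (n + 1), f g := by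
  rw [← Finset.sum_union]
  · refine Finset.sum_congr ?_ fun _ _ => rfl
    ext g
    simp only [Finset.mem_union, mem_ballF, mem_sphere]
    omega
  · refine Finset.disjoint_left.2 fun g h1 h2 => ?_
    have := mem_ballF.1 h1
    have := mem_sphere.1 h2
    omega

/-- Removing the first letter maps the sphere of radius `n + 1` to that of radius `n`, and the
fiber over `k` consists of the letters which do not cancel against `k`. -/
lemma sum_sphere_succ (f : FG r → ℝ) (n : ℕ) :
    ∑ g ∈ sphere r (n + 1), f ((firstLetter g)⁻¹ * g) =
      ∑ k ∈ sphere r n, ((Finset.univ.filter fun p : Fin r × Bool =>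
        k.toWord.head? ≠ some (p.1, !p.2)).card : ℝ) * f k := by
  have hrhs : ∀ k : FG r, ((Finset.univ.filter fun p : Fin r × Bool =>
      k.toWord.head? ≠ some (p.1, !p.2)).card : ℝ) * f k =
      ∑ _p ∈ Finset.univ.filter fun p : Fin r × Bool =>
        k.toWord.head? ≠ some (p.1, !p.2), f k := fun k => by
    rw [Finset.sum_const, nsmul_eq_mul]
  have hword : ∀ (p : Fin r × Bool) (k : FG r), k.toWord.head? ≠ some (p.1, !p.2) →
      (letter p * k).toWord = p :: k.toWord := fun p k h => by
    rw [toWord_letter_mul, if_neg h]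
  simp_rw [hrhs]
  rw [Finset.sum_sigma']
  symm
  refine Finset.sum_bij (fun x _ => letter x.2 * x.1) ?_ ?_ ?_ ?_
  · rintro ⟨k, p⟩ h
    simp only [Finset.mem_sigma, Finset.mem_filter, Finset.mem_univ, true_and] at h
    have := mem_sphere.1 h.1
    rw [mem_sphere, wlen, hword p k h.2, List.length_cons]
    exact congrArg Nat.succ this
  · rintro ⟨k, p⟩ h ⟨l, q⟩ hl heq
    simp only [Finset.mem_sigma, Finset.mem_filter, Finset.mem_univ, true_and] at h hl
    have e := congrArg FreeGroup.toWord heq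
    simp only at e
    rw [hword p k h.2, hword q l hl.2, List.cons.injEq] at e
    obtain ⟨rfl, e⟩ := e
    obtain rfl := FreeGroup.toWord_injective e
    rfl
  · intro g hg
    have h1 : g ≠ 1 := by
      intro h
      have := mem_sphere.1 hg
      rw [wlen_eq_zero.2 h] at this
      omega
    obtain ⟨p, k, hgk, hw, -, hk⟩ := exists_eq_letter_mul h1
    refine ⟨⟨k, p⟩, ?_, hgk.symm⟩
    simp only [Finset.mem_sigma, Finset.mem_filter, Finset.mem_univ, true_and, mem_sphere]
    have h2 := wlen_firstLetter_inv_mul h1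
    rw [hk, mem_sphere.1 hg] at h2
    refine ⟨by omega, fun hh => ?_⟩
    have e := toWord_letter_mul p k
    rw [← hgk, if_pos hh, hw] at e
    have := congrArg List.length e
    simp at this
    omega
  · rintro ⟨k, p⟩ h
    simp only [Finset.mem_sigma, Finset.mem_filter, Finset.mem_univ, true_and] at h
    have hw := hword p k h.2
    have : firstLetter (letter p * k) = letter p := by simp [firstLetter, hw]
    simp [this]

lemma card_filter_head {k : FG r} (hk : k ≠ 1) :
    ((Finset.univ.filter fun p : Fin r × Bool =>
      k.toWord.head? ≠ some (p.1, !p.2)).card : ℝ) = 2 * r - 1 := by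
  obtain ⟨q, k', -, hw, -, -⟩ := exists_eq_letter_mul hk
  have : (Finset.univ.filter fun p : Fin r × Bool => k.toWord.head? ≠ some (p.1, !p.2))
      = Finset.univ.erase (q.1, !q.2) := by
    ext p
    simp only [hw, List.head?_cons, Finset.mem_filter, Finset.mem_univ, true_and,
      Finset.mem_erase, and_true, ne_eq, Option.some.injEq]
    obtain ⟨i, b⟩ := p
    obtain ⟨j, c⟩ := q
    cases b <;> cases c <;> simp [eq_comm]
  rw [this, Finset.cast_card_erase_of_mem (Finset.mem_univ _)]
  simp [mul_comm]

variable {ord : Fin r × Bool → ℕ}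

/-- The order `wlt` as a lexicographic order. -/
def orderKey (ord : Fin r × Bool → ℕ) (g : FG r) : ℕ ×ₗ List ℕ :=
  toLex (wlen g, g.toWord.map ord)

lemma orderKey_injective (hord : Function.Injective ord) :
    Function.Injective (orderKey ord) := fun _ _ h =>
  FreeGroup.toWord_injective (List.map_injective_iff.2 hord (congrArg (fun z => (ofLex z).2) h))

lemma lex_iff_map_lt (hord : Function.Injective ord) (l l' : List (Fin r × Bool)) :
    List.Lex (fun p q => ord p < ord q) l l' ↔ l.map ord < l'.map ord := by
  induction l generalizing l' with
  | nil => cases l' <;> simp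
  | cons p l ih =>
    cases l' with
    | nil => simp
    | cons q l' =>
      rw [List.map_cons, List.map_cons, List.cons_lt_cons_iff, ← ih l']
      constructor
      · intro h
        cases h with
        | rel h => exact Or.inl h
        | cons h => exact Or.inr ⟨rfl, h⟩
      · rintro (h | ⟨h, h'⟩)
        · exact List.Lex.rel h
        · rw [hord h]
          exact List.Lex.cons h'

lemma wlt_iff (hord : Function.Injective ord) (g h : FG r) :
    wlt ord g h ↔ orderKey ord g < orderKey ord h := by
  rw [wlt, lex_iff_map_lt hord, orderKey, orderKey, Prod.Lex.toLex_lt_toLex]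

lemma wlen_le_of_wlt {g h : FG r} (hgh : wlt ord g h) : wlen g ≤ wlen h :=
  hgh.elim le_of_lt fun h => h.1.le

instance finite_Pre (g : FG r) : Finite (Pre ord g) :=
  ((Set.toFinite (ball r (wlen g))).subset fun _ hk => wlen_le_of_wlt hk).to_subtype

/-- The set `Pre(g)` as a finset. -/
noncomputable def preF (ord : Fin r × Bool → ℕ) (g : FG r) : Finset (FG r) :=
  (Set.toFinite (Pre ord g)).toFinset

lemma mem_preF {g k : FG r} : k ∈ preF ord g ↔ wlt ord k g := by
  simp [preF, Pre]

lemma coe_preF (g : FG r) : (preF ord g : Set (FG r)) = Pre ord g := by simp [preF]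

/-- Left multiplication by the first letter of `g` maps `Pre(s⁻¹g)` into `Pre(g)`. -/
lemma firstLetter_smul_preF_subset {g : FG r} (hg : g ≠ 1) :
    firstLetter g • preF ord ((firstLetter g)⁻¹ * g) ⊆ preF ord g := by
  obtain ⟨p, k, -, hw, hf, hk⟩ := exists_eq_letter_mul hg
  rw [hk, hf]
  intro x hx
  obtain ⟨y, hy, rfl⟩ := Finset.mem_smul_finset.1 hx
  rw [mem_preF, wlt] at *
  simp only [smul_eq_mul, wlen, hw, toWord_letter_mul, List.length_cons] at hy ⊢
  split_ifs with h
  · left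
    rw [List.length_tail]
    rcases hy with hy | hy <;> omega
  · rcases hy with hy | hy
    · left
      rw [List.length_cons]
      omega
    · right
      exact ⟨by rw [List.length_cons, hy.1], List.Lex.cons hy.2⟩

end Words

/-! ### Invariant strongly subadditive set functions on the free group -/

section SetFunction

variable {r : ℕ} {ord : Fin r × Bool → ℕ} {H : Finset (FG r) → ℝ}

/-- The increment of a set function at `g` over the predecessors of `g`. -/
noncomputable def marg (H : Finset (FG r) → ℝ) (ord : Fin r × Bool → ℕ) (g : FG r) : ℝ :=
  H ({g} ∪ preF ord g) - H (preF ord g)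

lemma marg_le_marg (hsub : ∀ F K L, K ⊆ L → H (F ∪ L) - H L ≤ H (F ∪ K) - H K)
    (hinv : ∀ (g : FG r) F, H (g • F) = H F) {g : FG r} (hg : g ≠ 1) :
    marg H ord g ≤ marg H ord ((firstLetter g)⁻¹ * g) := by
  have h := hsub {g} _ _ (firstLetter_smul_preF_subset (ord := ord) hg)
  have h' : ({g} : Finset (FG r)) ∪ firstLetter g • preF ord ((firstLetter g)⁻¹ * g) =
      firstLetter g • ({(firstLetter g)⁻¹ * g} ∪ preF ord ((firstLetter g)⁻¹ * g)) := by
    rw [Finset.smul_finset_union, Finset.smul_finset_singleton, smul_eq_mul, mul_inv_cancel_left]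
  rwa [h', hinv, hinv] at h

lemma sum_marg (hord : Function.Injective ord) (h0 : H ∅ = 0) (F : Finset (FG r))
    (hF : ∀ g ∈ F, ∀ k, wlt ord k g → k ∈ F) : ∑ g ∈ F, marg H ord g = H F := by
  induction hn : F.card generalizing F with
  | zero => rw [Finset.card_eq_zero.1 hn, Finset.sum_empty, h0]
  | succ n ih =>
    obtain ⟨g, hg, hmax⟩ := F.exists_max_image (orderKey ord) (Finset.card_pos.1 (by omega))
    have hpre : F.erase g = preF ord g := by
      ext k
      rw [Finset.mem_erase, mem_preF]
      refine ⟨fun ⟨hne, hk⟩ => (wlt_iff hord k g).2 (lt_of_le_of_ne (hmax k hk)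
        fun h => hne (orderKey_injective hord h)), fun hk => ⟨?_, hF g hg k hk⟩⟩
      rintro rfl
      exact lt_irrefl _ ((wlt_iff hord _ _).1 hk)
    have herase : ∑ k ∈ F.erase g, marg H ord k = H (F.erase g) := by
      refine ih _ (fun k hk l hl => ?_) (by rw [Finset.card_erase_of_mem hg, hn]; rfl)
      rw [hpre, mem_preF] at hk ⊢
      rw [wlt_iff hord] at hk hl ⊢
      exact hl.trans hk
    rw [← Finset.add_sum_erase _ _ hg, herase, marg, ← hpre, ← Finset.insert_eq,
      Finset.insert_erase hg]
    ring

lemma sum_marg_ballF (hord : Function.Injective ord) (h0 : H ∅ = 0) (n : ℕ) :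
    ∑ g ∈ ballF r n, marg H ord g = H (ballF r n) :=
  sum_marg hord h0 _ fun _ hg _ hk => mem_ballF.2 ((wlen_le_of_wlt hk).trans (mem_ballF.1 hg))

/-- The difference of the increments at `s⁻¹g` and at `g`, `s` being the first letter of `g`. -/
noncomputable def decay (H : Finset (FG r) → ℝ) (ord : Fin r × Bool → ℕ) (g : FG r) : ℝ :=
  marg H ord ((firstLetter g)⁻¹ * g) - marg H ord g

lemma decay_one : decay H ord 1 = 0 := by simp [decay, firstLetter]

lemma sum_decay_ballF_succ (hord : Function.Injective ord) (h0 : H ∅ = 0) (n : ℕ) :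
    ∑ g ∈ ballF r (n + 1), decay H ord g =
      2 * H {1} + (2 * r - 1) * H (ballF r n) - H (ballF r (n + 1)) := by
  have hsphere : ∀ n, ∑ g ∈ sphere r (n + 1), marg H ord g =
      H (ballF r (n + 1)) - H (ballF r n) := fun n => by
    rw [← sum_marg_ballF hord h0, ← sum_marg_ballF hord h0, sum_ballF_succ]
    ring
  induction n with
  | zero =>
    have hs : sphere r 0 = {1} := by ext g; simp [mem_sphere, wlen_eq_zero]
    have h1 : marg H ord 1 = H {1} := by
      have := sum_marg_ballF (r := r) hord h0 0
      rwa [ballF_zero, Finset.sum_singleton] at this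
    rw [sum_ballF_succ]
    simp only [decay, Finset.sum_sub_distrib]
    rw [sum_sphere_succ, hsphere, hs, ballF_zero]
    simp [h1, firstLetter]
    ring
  | succ n ih =>
    have hmul : ∑ g ∈ sphere r (n + 2), marg H ord ((firstLetter g)⁻¹ * g) =
        (2 * r - 1) * (H (ballF r (n + 1)) - H (ballF r n)) := by
      rw [sum_sphere_succ, ← hsphere, Finset.mul_sum]
      refine Finset.sum_congr rfl fun k hk => ?_
      rw [card_filter_head]
      intro h
      rw [mem_sphere, wlen_eq_zero.2 h] at hk
      omega
    rw [sum_ballF_succ, ih]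
    simp only [decay, Finset.sum_sub_distrib]
    rw [hmul, hsphere]
    ring

lemma biUnion_sub_le_sum {ι : Type*} [DecidableEq ι]
    (hsub : ∀ F K L, K ⊆ L → H (F ∪ L) - H L ≤ H (F ∪ K) - H K)
    (s : Finset ι) (F : ι → Finset (FG r)) (K : Finset (FG r)) :
    H (s.biUnion F ∪ K) - H K ≤ ∑ i ∈ s, (H (F i ∪ K) - H K) := by
  induction s using Finset.induction_on with
  | empty => simp
  | insert i s hi ih =>
    rw [Finset.sum_insert hi, Finset.biUnion_insert, Finset.union_assoc]
    have := hsub (F i) K (s.biUnion F ∪ K) Finset.subset_union_right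
    linarith

lemma ballF_succ_sub_le (hsub : ∀ F K L, K ⊆ L → H (F ∪ L) - H L ≤ H (F ∪ K) - H K) (n : ℕ) :
    H (ballF r (n + 1)) - H (ballF r n) ≤
      ∑ p : Fin r × Bool, (H (letter p • ballF r n ∪ ballF r n) - H (ballF r n)) := by
  rw [ballF_succ]
  exact biUnion_sub_le_sum hsub _ _ _

lemma smul_union_self (hinv : ∀ (g : FG r) F, H (g • F) = H F) (g : FG r) (F : Finset (FG r)) :
    H (g • F ∪ F) = H (g⁻¹ • F ∪ F) := by
  rw [← hinv g (g⁻¹ • F ∪ F), Finset.smul_finset_union, smul_inv_smul, Finset.union_comm]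

lemma sum_letter_smul_union_le (hsub : ∀ F K L, K ⊆ L → H (F ∪ L) - H L ≤ H (F ∪ K) - H K)
    (hinv : ∀ (g : FG r) F, H (g • F) = H F) (n : ℕ) :
    ∑ p : Fin r × Bool, (H (letter p • ballF r (n + 1) ∪ ballF r (n + 1)) - H (ballF r (n + 1))) ≤
      (2 * r - 1) * (H (ballF r (n + 1)) - H (ballF r n)) := by
  have hp : ∀ p : Fin r × Bool,
      H (letter p • ballF r (n + 1) ∪ ballF r (n + 1)) - H (ballF r (n + 1)) ≤
        H (ballF r (n + 1)) - H (letter p • ballF r n ∪ ballF r n) := fun p => by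
    have hD : letter p • ballF r n ∪ ballF r n ⊆ letter p • ballF r (n + 1) := by
      refine Finset.union_subset (Finset.smul_finset_subset_smul_finset (ballF_mono n.le_succ)) ?_
      rw [← Finset.smul_finset_subset_smul_finset_iff (a := (letter p)⁻¹), inv_smul_smul,
        letter_inv]
      exact letter_smul_ballF_subset _ n
    have hD' : letter p • ballF r n ∪ ballF r n ⊆ ballF r (n + 1) :=
      Finset.union_subset (letter_smul_ballF_subset p n) (ballF_mono n.le_succ)
    have h := hsub (ballF r (n + 1)) _ _ hD
    rwa [hinv, Finset.union_eq_left.2 hD', Finset.union_comm] at h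
  have h1 := Finset.sum_le_sum fun p (_ : p ∈ Finset.univ) => hp p
  have h2 := ballF_succ_sub_le hsub n
  simp only [Finset.sum_sub_distrib, Finset.sum_const, Finset.card_univ, Fintype.card_prod,
    Fintype.card_fin, Fintype.card_bool, nsmul_eq_mul, Nat.cast_mul, Nat.cast_ofNat] at *
  linarith

/-- The quantity `F_G` of a ball, for a set function. -/
noncomputable def ballFunctional (H : Finset (FG r) → ℝ) (n : ℕ) : ℝ :=
  (1 - 2 * (r : ℝ)) * H (ballF r n)
    + ∑ i : Fin r, H (FreeGroup.of i • ballF r n ∪ ballF r n)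

lemma sum_letter_smul_union (hinv : ∀ (g : FG r) F, H (g • F) = H F) (F : Finset (FG r)) :
    ∑ p : Fin r × Bool, H (letter p • F ∪ F) =
      2 * ∑ i : Fin r, H (FreeGroup.of i • F ∪ F) := by
  rw [Fintype.sum_prod_type, Finset.mul_sum]
  refine Finset.sum_congr rfl fun i _ => ?_
  simp only [Fintype.sum_bool, letter, if_true, Bool.false_eq_true, if_false]
  rw [← smul_union_self hinv]
  ring

lemma half_decay_le_ballFunctional (hord : Function.Injective ord) (h0 : H ∅ = 0)
    (hsub : ∀ F K L, K ⊆ L → H (F ∪ L) - H L ≤ H (F ∪ K) - H K)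
    (hinv : ∀ (g : FG r) F, H (g • F) = H F) (n : ℕ) :
    H {1} - 1 / 2 * ∑ g ∈ ballF r (n + 1), decay H ord g ≤ ballFunctional H n := by
  have h := ballF_succ_sub_le hsub n
  rw [Finset.sum_sub_distrib, sum_letter_smul_union hinv] at h
  simp only [Finset.sum_const, Finset.card_univ, Fintype.card_prod,
    Fintype.card_fin, Fintype.card_bool, nsmul_eq_mul, Nat.cast_mul, Nat.cast_ofNat] at h
  rw [sum_decay_ballF_succ hord h0, ballFunctional]
  linarith

lemma ballFunctional_succ_le (hord : Function.Injective ord) (h0 : H ∅ = 0)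
    (hsub : ∀ F K L, K ⊆ L → H (F ∪ L) - H L ≤ H (F ∪ K) - H K)
    (hinv : ∀ (g : FG r) F, H (g • F) = H F) (n : ℕ) :
    ballFunctional H (n + 1) ≤ H {1} - 1 / 2 * ∑ g ∈ ballF r (n + 1), decay H ord g := by
  have h := sum_letter_smul_union_le hsub hinv n
  rw [Finset.sum_sub_distrib, sum_letter_smul_union hinv] at h
  simp only [Finset.sum_const, Finset.card_univ, Fintype.card_prod,
    Fintype.card_fin, Fintype.card_bool, nsmul_eq_mul, Nat.cast_mul, Nat.cast_ofNat] at h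
  rw [sum_decay_ballF_succ hord h0, ballFunctional]
  linarith

/-- The infimum of `F_G` over the balls, in terms of the decays. -/
lemma iInf_ballFunctional (hord : Function.Injective ord) (h0 : H ∅ = 0)
    (hsub : ∀ F K L, K ⊆ L → H (F ∪ L) - H L ≤ H (F ∪ K) - H K)
    (hinv : ∀ (g : FG r) F, H (g • F) = H F) :
    ⨅ n : ℕ, (ballFunctional H n : EReal) =
      (H {1} : EReal) - ((1 / 2 : ℝ) : EReal) * ((∑' g : {g : FG r // g ≠ 1},
        ENNReal.ofReal (decay H ord g.1) : ℝ≥0∞) : EReal) := by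
  have hnonneg : ∀ g : FG r, 0 ≤ decay H ord g := fun g => by
    by_cases hg : g = 1
    · rw [hg, decay_one]
    · exact sub_nonneg.2 (marg_le_marg hsub hinv hg)
  have hsum : ∑' g : {g : FG r // g ≠ 1}, ENNReal.ofReal (decay H ord g.1) =
      ∑' g : FG r, ENNReal.ofReal (decay H ord g) := by
    refine tsum_subtype_eq_of_support_subset (f := fun g => ENNReal.ofReal (decay H ord g))
      (s := {g : FG r | g ≠ 1}) fun g hg h1 => hg ?_
    simp [h1, decay_one]
  rw [hsum]
  have htend : Tendsto (fun n => ∑ g ∈ ballF r n, ENNReal.ofReal (decay H ord g)) atTop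
      (nhds (∑' g : FG r, ENNReal.ofReal (decay H ord g))) :=
    ENNReal.summable.hasSum.comp (tendsto_atTop_finset_of_monotone ballF_mono
      fun g => ⟨wlen g, mem_ballF.2 le_rfl⟩)
  have hcont : Continuous fun t : ℝ≥0∞ =>
      (H {1} : EReal) - ((1 / 2 : ℝ) : EReal) * (t : EReal) := by
    refine continuous_iff_continuousAt.2 fun t => ?_
    have hmul : ContinuousAt (fun t : ℝ≥0∞ => ((1 / 2 : ℝ) : EReal) * (t : EReal)) t :=
      (EReal.continuousAt_mul (p := (((1 / 2 : ℝ) : EReal), (t : EReal))) (by norm_num)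
        (by norm_num) (by norm_num) (by norm_num)).comp₂ continuousAt_const
          continuous_coe_ennreal_ereal.continuousAt
    exact (EReal.continuousAt_add (p := ((H {1} : EReal), -(((1 / 2 : ℝ) : EReal) * (t : EReal))))
      (by simp) (by simp)).comp₂ continuousAt_const hmul.neg
  have hanti : Antitone fun t : ℝ≥0∞ =>
      (H {1} : EReal) - ((1 / 2 : ℝ) : EReal) * (t : EReal) := fun s t hst =>
    EReal.sub_le_sub le_rfl (mul_le_mul_of_nonneg_left (EReal.coe_ennreal_le_coe_ennreal_iff.2 hst)
      (by norm_num))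
  have hpart : ∀ n, (H {1} : EReal) - ((1 / 2 : ℝ) : EReal) *
      ((∑ g ∈ ballF r n, ENNReal.ofReal (decay H ord g) : ℝ≥0∞) : EReal) =
      ((H {1} - 1 / 2 * ∑ g ∈ ballF r n, decay H ord g : ℝ) : EReal) := fun n => by
    rw [← ENNReal.ofReal_sum_of_nonneg fun g _ => hnonneg g, EReal.coe_ennreal_ofReal,
      max_eq_left (Finset.sum_nonneg fun g _ => hnonneg g)]
    push_cast
    rfl
  refine le_antisymm ?_ (le_iInf fun n => ?_)
  · refine ge_of_tendsto' ((hcont.tendsto _).comp ((tendsto_add_atTop_iff_nat 1).2 htend))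
      fun n => (iInf_le _ (n + 1)).trans ?_
    simp only [Function.comp_apply]
    rw [hpart]
    exact EReal.coe_le_coe_iff.2 (ballFunctional_succ_le hord h0 hsub hinv n)
  · refine (hanti (ENNReal.sum_le_tsum (ballF r (n + 1)))).trans ?_
    simp only []
    rw [hpart]
    exact EReal.coe_le_coe_iff.2 (half_decay_le_ballFunctional hord h0 hsub hinv n)

end SetFunction

/-! ### The decay formula for relative entropy -/

section Link

variable {r : ℕ} {X : Type*} {m : MeasurableSpace X} [mX : MeasurableSpace X]
  {μ : Measure X} [IsProbabilityMeasure μ] {T : BorelAction (FG r) X} {a : X → ℕ}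

lemma idecay_eq_decay (hm : m ≤ mX) (hT : T.Preserves μ) (ha : Measurable a)
    (hent : Hpart μ a < ⊤) (ord : Fin r × Bool → ℕ) (g : FG r) :
    idecay m μ T ord a g = decay (joinEnt m μ T a) ord g := by
  have h : ∀ k : FG r, (condEntS (m ⊔ T.partSA (Pre ord k) a) μ (T.tr k a)).toReal =
      marg (joinEnt m μ T a) ord k := fun k => by
    have hM : m ⊔ MeasurableSpace.comap (T.joinF (preF ord k : Set (FG r)) a) ⊤ ≤ mX :=
      sup_comap_le hm (measurableSet_joinF_fiber (T := T) _ ha)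
    rw [marg, ← toReal_condEntS_sup hm hT ha hent, ← coe_preF, partSA_eq_comap_joinF,
      ← condEntS_joinF_singleton hM ha]
    exact congrArg ENNReal.toReal (condEntS_joinF_congr hM ha (by simp))
  rw [idecay, decay, h, h]

lemma fSeqRel_eq_ballFunctional (hm : m ≤ mX) (ha : Measurable a) (n : ℕ) :
    fSeqRel m μ T a n = ballFunctional (joinEnt m μ T a) n := by
  have hf : ∀ F : Finset (FG r), ∀ i, MeasurableSet (T.joinF (F : Set (FG r)) a ⁻¹' {i}) :=
    fun F => measurableSet_joinF_fiber _ ha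
  have hf' : ∀ i, MeasurableSet (T.joinF (ball r n) a ⁻¹' {i}) := measurableSet_joinF_fiber _ ha
  have hball : condEntS m μ (T.joinF (ball r n) a) =
      condEntS m μ (T.joinF (ballF r n : Set (FG r)) a) :=
    condEntS_joinF_congr hm ha (coe_ballF n).symm
  rw [fSeqRel, FFrel, ballFunctional, hball]
  refine congrArg₂ (· + ·) rfl (Finset.sum_congr rfl fun i _ => ?_)
  refine congrArg ENNReal.toReal (condEntS_congr_factor hm (fun q => ?_) (hf _) fun x y => ?_)
  · have hq : (fun x => (T.tr (FreeGroup.of i) (T.joinF (ball r n) a) x,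
        T.joinF (ball r n) a x)) ⁻¹' {q} =
        T.act (FreeGroup.of i)⁻¹ ⁻¹' (T.joinF (ball r n) a ⁻¹' {q.1}) ∩
          T.joinF (ball r n) a ⁻¹' {q.2} := by
      ext x
      simp [BorelAction.tr, Prod.ext_iff]
    rw [hq]
    exact (T.measurable_act _ (hf' _)).inter (hf' _)
  · have hsmul : ∀ k, k ∈ FreeGroup.of i • ballF r n ↔ ∃ f ∈ ball r n, FreeGroup.of i * f = k := by
      simp [Finset.mem_smul_finset, ← coe_ballF]
    simp only [Prod.ext_iff, joinF_eq_iff, BorelAction.tr, ← T.act_mul, ← mul_inv_rev]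
    simp only [Finset.coe_union, Set.mem_union, Finset.mem_coe, hsmul, mem_ballF, or_imp,
      forall_and, forall_exists_index, and_imp, forall_apply_eq_imp_iff₂]
    rfl

end Link

/-- The independence-decay formula for the relative f-invariant entropy:
`f_G(X, μ/Σ) = H(α/Σ) − (1/2)·∑_{1 ≠ g ∈ G} δ(g, α/Σ)`, each `δ(g, α/Σ) ≥ 0`. -/
theorem statement6 {r : ℕ} (hr : 1 ≤ r) {X : Type*}
    (m : MeasurableSpace X) [mX : MeasurableSpace X] [StandardBorelSpace X]
    (μ : Measure X) [IsProbabilityMeasure μ]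
    (T : BorelAction (FG r) X) (hT : T.Preserves μ)
    (hm : InvariantSA m T)
    (ord : Fin r × Bool → ℕ) (hord : Function.Injective ord)
    (a : X → ℕ) (ha : Measurable a) (hgen : T.Generating a μ) (hent : Hpart μ a < ⊤) :
    (∀ g : FG r, g ≠ 1 → 0 ≤ idecay m μ T ord a g) ∧
      fInvRel m μ T a
        = ((condEntS m μ a : ℝ≥0∞) : EReal)
          - ((1 / 2 : ℝ) : EReal) * ((∑' g : {g : FG r // g ≠ 1},
              ENNReal.ofReal (idecay m μ T ord a g.1) : ℝ≥0∞) : EReal) := by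
  have h0 : joinEnt m μ T a ∅ = 0 := joinEnt_empty hm.1
  have hsub : ∀ F K L : Finset (FG r), K ⊆ L →
      joinEnt m μ T a (F ∪ L) - joinEnt m μ T a L ≤ joinEnt m μ T a (F ∪ K) - joinEnt m μ T a K :=
    fun F _ _ h => joinEnt_union_sub_anti hm.1 hT ha hent F h
  have hinv : ∀ (g : FG r) (F : Finset (FG r)), joinEnt m μ T a (g • F) = joinEnt m μ T a F :=
    joinEnt_smul hm hT ha
  have hdecay := idecay_eq_decay hm.1 hT ha hent ord
  refine ⟨fun g hg => ?_, ?_⟩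
  · rw [hdecay]
    exact sub_nonneg.2 (marg_le_marg hsub hinv hg)
  · have hone : condEntS m μ (T.joinF (({1} : Finset (FG r)) : Set (FG r)) a) = condEntS m μ a := by
      refine condEntS_congr_factor hm.1 (measurableSet_joinF_fiber _ ha)
        (fun i => ha (measurableSet_singleton i)) fun x y => ?_
      rw [joinF_eq_iff]
      simp [T.act_one]
    have hcoe : ((condEntS m μ a : ℝ≥0∞) : EReal) = (joinEnt m μ T a {1} : EReal) := by
      rw [joinEnt, EReal.coe_ennreal_toReal (condEntS_joinF_ne_top hm.1 hT ha hent _), hone]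
    simp only [fInvRel, fSeqRel_eq_ballFunctional hm.1 ha, hdecay, hcoe]
    exact iInf_ballFunctional hord h0 hsub hinv

end FPaper
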